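/- Let ω ∈ ℂ be the primitive cube root of unity ω = (−1 + √−3)/2 (so ω² + ω + 1 = 0). For every nonempty list c of integers with every entry ≥ 2, the complex numbers 𝓡(c)(ω) and 𝓢(c)(ω) (evaluations of the polynomials at q = ω) both belong to the set {0, 1, −1, ω, −ω, ω², −ω²}. -/

import Mathlib

open Polynomial

/-- The `q`-deformation `[n]_q = 1 + q + ⋯ + q^{n-1}` of a nonnegative integer. -/
noncomputable def qNat (n : ℕ) : Polynomial ℤ := (Finset.range n).sum fun i => X ^ i

/-- The matrix `M_q⁻(c) = (([c]_q, -q^{c-1}), (1, 0))` over `ℤ[q]`. -/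
noncomputable def MqNeg (c : ℕ) : Matrix (Fin 2) (Fin 2) (Polynomial ℤ) :=
  !![qNat c, -(X ^ (c - 1)); 1, 0]

/-- `𝓡(c)`: the (0,0) entry of `M_q⁻(c₁)⋯M_q⁻(c_l)`. -/
noncomputable def Rpoly (L : List ℕ) : Polynomial ℤ := ((L.map MqNeg).prod) 0 0

/-- `𝓢(c)`: the (1,0) entry of `M_q⁻(c₁)⋯M_q⁻(c_l)`. -/
noncomputable def Spoly (L : List ℕ) : Polynomial ℤ := ((L.map MqNeg).prod) 1 0

/-- `r(c) = 𝓡(c)(1)`. -/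
noncomputable def rNum (L : List ℕ) : ℤ := (Rpoly L).eval 1

/-- `s(c) = 𝓢(c)(1)`. -/
noncomputable def sNum (L : List ℕ) : ℤ := (Spoly L).eval 1

/-- The values at a root `w` of `X² + X + 1` of the entries in the first row of `M_q⁻(c)`. -/
theorem aeval_MqNeg_row {w : ℂ} (hw : w ^ 2 + w + 1 = 0) (k : ℕ) :
    (aeval w (qNat (3 * k + 1)) = 1 ∧ w ^ (3 * k) = 1) ∧
    (aeval w (qNat (3 * k + 2)) = 1 + w ∧ w ^ (3 * k + 1) = w) ∧
    (aeval w (qNat (3 * k + 3)) = 0 ∧ w ^ (3 * k + 2) = w ^ 2) := by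
  have h3 : w ^ 3 = 1 := by linear_combination (w - 1) * hw
  have hp : w ^ (3 * k) = 1 := by rw [pow_mul, h3, one_pow]
  have h0 : ∑ i ∈ Finset.range (3 * k), w ^ i = 0 := by
    clear hp
    induction k with
    | zero => simp
    | succ k ih =>
      rw [show 3 * (k + 1) = 3 * k + 1 + 1 + 1 by ring, Finset.sum_range_succ,
        Finset.sum_range_succ, Finset.sum_range_succ, ih]
      linear_combination w ^ (3 * k) * hw
  simp only [qNat, map_sum, map_add, map_mul, map_pow, aeval_X, Finset.sum_range_succ, h0, pow_add, hp]
  refine ⟨⟨by ring, trivial⟩, ⟨by ring, by ring⟩, ⟨by linear_combination hw, by ring⟩⟩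

theorem Rpoly_cons (c : ℕ) (L : List ℕ) :
    Rpoly (c :: L) = qNat c * Rpoly L - X ^ (c - 1) * Spoly L := by
  simp [Rpoly, Spoly, MqNeg, Matrix.mul_apply, Fin.sum_univ_two]
  ring

theorem Spoly_cons (c : ℕ) (L : List ℕ) : Spoly (c :: L) = Rpoly L := by
  simp [Rpoly, Spoly, MqNeg, Matrix.mul_apply, Fin.sum_univ_two]

/-- The four lines through the origin that are permuted by the matrices `M_q⁻(c)` at `q = w`, each
with the sixth roots of unity as scalars. -/
def OnTetrahedralLine (w R S : ℂ) : Prop :=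
  ∃ u : ℂ, u ^ 6 = 1 ∧
    ((R = u ∧ S = 0) ∨ (R = 0 ∧ S = u) ∨ (R = u ∧ S = u) ∨ (R = u ∧ S = -w * u))

theorem OnTetrahedralLine.step {w R S a b : ℂ} (hw : w ^ 2 + w + 1 = 0)
    (h : OnTetrahedralLine w R S)
    (hab : (a = 1 ∧ b = 1) ∨ (a = 1 + w ∧ b = w) ∨ (a = 0 ∧ b = w ^ 2)) :
    OnTetrahedralLine w (a * R - b * S) R := by
  have h3 : w ^ 3 = 1 := by linear_combination (w - 1) * hw
  obtain ⟨u, hu, h⟩ := h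
  have hneg : (-u) ^ 6 = 1 := by linear_combination hu
  have hw1 : (-w * u) ^ 6 = 1 := by linear_combination w ^ 6 * hu + (w ^ 3 + 1) * h3
  have hw2 : (-w ^ 2 * u) ^ 6 = 1 := by
    linear_combination w ^ 12 * hu + (w ^ 9 + w ^ 6 + w ^ 3 + 1) * h3
  rcases h with ⟨rfl, rfl⟩ | ⟨rfl, rfl⟩ | ⟨rfl, rfl⟩ | ⟨rfl, rfl⟩ <;>
    rcases hab with ⟨rfl, rfl⟩ | ⟨rfl, rfl⟩ | ⟨rfl, rfl⟩
  · exact ⟨_, hu, .inr (.inr (.inl ⟨by ring, rfl⟩))⟩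
  · exact ⟨_, hw2, .inr (.inr (.inr ⟨by linear_combination R * hw, by linear_combination -R * h3⟩))⟩
  · exact ⟨_, hu, .inr (.inl ⟨by ring, rfl⟩)⟩
  · exact ⟨_, hneg, .inl ⟨by ring, rfl⟩⟩
  · exact ⟨_, hw1, .inl ⟨by ring, rfl⟩⟩
  · exact ⟨_, hw2, .inl ⟨by ring, rfl⟩⟩
  · exact ⟨_, hu, .inr (.inl ⟨by ring, rfl⟩)⟩
  · exact ⟨_, hu, .inr (.inr (.inl ⟨by ring, rfl⟩))⟩
  · exact ⟨_, hw2, .inr (.inr (.inr ⟨by ring, by linear_combination -S * h3⟩))⟩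
  · exact ⟨_, hw2, .inr (.inr (.inr ⟨by linear_combination R * hw, by linear_combination -R * h3⟩))⟩
  · exact ⟨_, hu, .inr (.inl ⟨by linear_combination R * hw, rfl⟩)⟩
  · exact ⟨_, hu, .inr (.inr (.inl ⟨by linear_combination R * h3, rfl⟩))⟩

theorem onTetrahedralLine_aeval {w : ℂ} (hw : w ^ 2 + w + 1 = 0) (L : List ℕ)
    (hL : ∀ y ∈ L, 1 ≤ y) : OnTetrahedralLine w (aeval w (Rpoly L)) (aeval w (Spoly L)) := by
  induction L with
  | nil => exact ⟨1, by simp, .inl ⟨by simp [Rpoly], by simp [Spoly]⟩⟩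
  | cons c L ih =>
    have hc : 1 ≤ c := hL c (by simp)
    rw [Rpoly_cons, Spoly_cons, map_sub, map_mul, map_mul, map_pow, aeval_X]
    refine (ih fun y hy => hL y (by simp [hy])).step hw ?_
    obtain ⟨h1, h2, h3⟩ := aeval_MqNeg_row hw ((c - 1) / 3)
    obtain h | h | h : c = 3 * ((c - 1) / 3) + 1 ∨ c = 3 * ((c - 1) / 3) + 2 ∨
        c = 3 * ((c - 1) / 3) + 3 := by omega
    all_goals
      generalize (c - 1) / 3 = k at *
      subst h
    · exact .inl h1
    · exact .inr (.inl h2)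
    · exact .inr (.inr h3)

theorem mem_of_pow_six_eq_one {w u : ℂ} (hw : w ^ 2 + w + 1 = 0) (hu : u ^ 6 = 1) :
    u ∈ ({0, 1, -1, w, -w, w ^ 2, -w ^ 2} : Set ℂ) := by
  have h : (u - 1) * ((u + 1) * ((u - w) * ((u + w) * ((u - w ^ 2) * (u + w ^ 2))))) = 0 := by
    have hplus : (u - w) * (u - w ^ 2) = u ^ 2 + u + 1 := by
      linear_combination (w - 1 - u) * hw
    have hminus : (u + w) * (u + w ^ 2) = u ^ 2 - u + 1 := by
      linear_combination (w - 1 + u) * hw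
    calc _ = (u - 1) * (u + 1) * ((u - w) * (u - w ^ 2)) * ((u + w) * (u + w ^ 2)) := by ring
      _ = 0 := by rw [hplus, hminus]; linear_combination hu
  simp only [mul_eq_zero, sub_eq_zero, add_eq_zero_iff_eq_neg] at h
  simp only [Set.mem_insert_iff, Set.mem_singleton_iff]
  tauto

/-- For `ω = (−1 + √−3)/2` and any negative continued-fraction list `L`, the values
`𝓡(L)(ω)` and `𝓢(L)(ω)` lie in `{0, ±1, ±ω, ±ω²}`. -/
theorem stmt12 (ω : ℂ) (hω : ω = (-1 + (Real.sqrt 3 : ℂ) * Complex.I) / 2)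
    (L : List ℕ) (hL : L ≠ []) (hL2 : ∀ y ∈ L, 2 ≤ y) :
    (Polynomial.aeval ω) (Rpoly L) ∈ ({0, 1, -1, ω, -ω, ω ^ 2, -ω ^ 2} : Set ℂ) ∧
    (Polynomial.aeval ω) (Spoly L) ∈ ({0, 1, -1, ω, -ω, ω ^ 2, -ω ^ 2} : Set ℂ) := by
  have hw : ω ^ 2 + ω + 1 = 0 := by
    have h3 : (Real.sqrt 3 : ℂ) ^ 2 = 3 := by
      rw [← Complex.ofReal_pow, Real.sq_sqrt (by norm_num)]
      norm_num
    rw [hω]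
    linear_combination (Complex.I ^ 2 / 4) * h3 + (3 / 4) * Complex.I_sq
  obtain ⟨u, hu, h⟩ := onTetrahedralLine_aeval hw L fun y hy => one_le_two.trans (hL2 y hy)
  have h3 : ω ^ 3 = 1 := by linear_combination (ω - 1) * hw
  have hωu : (-ω * u) ^ 6 = 1 := by linear_combination ω ^ 6 * hu + (ω ^ 3 + 1) * h3
  have hmem := mem_of_pow_six_eq_one hw hu
  have hmem' := mem_of_pow_six_eq_one hw hωu
  rcases h with ⟨hR, hS⟩ | ⟨hR, hS⟩ | ⟨hR, hS⟩ | ⟨hR, hS⟩ <;> rw [hR, hS]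
  · exact ⟨hmem, by simp⟩
  · exact ⟨by simp, hmem⟩
  · exact ⟨hmem, hmem⟩
  · exact ⟨hmem, hmem'⟩
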